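/- 2-nested word automata are determinizable on the subclass of 2-wave words: for every 2NWA A over Σ there exists a deterministic 2NWA A' over Σ such that L_WW2(A) = L_WW2(A'), i.e. A and A' accept exactly the same 2-wave words. -/

import Mathlib

/-- A matching relation of length `n`, on positions `1, …, n`. -/
structure Matching (n : ℕ) where
  rel : ℕ → ℕ → Prop
  ordered : ∀ i j, rel i j → 1 ≤ i ∧ i < j ∧ j ≤ n
  unique : ∀ i j k l, rel i j → rel k l →
    (i = k ∨ i = l ∨ j = k ∨ j = l) → i = k ∧ j = l
  noncrossing : ∀ i j k l, rel i j → rel k l → i < k → k < j → l < j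

/-- A 2-nested word: a word together with two matchings of its length. -/
structure TwoNW (α : Type) where
  word : List α
  M1 : Matching word.length
  M2 : Matching word.length

def Matching.IsCall {n : ℕ} (M : Matching n) (i : ℕ) : Prop := ∃ j, M.rel i j
def Matching.IsRet {n : ℕ} (M : Matching n) (i : ℕ) : Prop := ∃ j, M.rel j i
def Matching.IsInt {n : ℕ} (M : Matching n) (i : ℕ) : Prop := ¬ M.IsCall i ∧ ¬ M.IsRet i

/-- `(i1,i2,i3,i4)` is a 2-wave of the pair of matchings `(M1, M2)`. -/
def IsTwoWaveQuad {n : ℕ} (M1 M2 : Matching n) (i1 i2 i3 i4 : ℕ) : Prop :=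
  i1 < i2 ∧ i2 < i3 ∧ i3 < i4 ∧
  M1.rel i1 i2 ∧ M1.rel i3 i4 ∧ M2.rel i2 i3 ∧ M2.rel i1 i4

/-- A 2-wave structure: every arch of `M1 ∪ M2` is an arch of some 2-wave. -/
def IsWaveStructure {n : ℕ} (M1 M2 : Matching n) : Prop :=
  (∀ i j, M1.rel i j → ∃ i1 i2 i3 i4, IsTwoWaveQuad M1 M2 i1 i2 i3 i4 ∧
      ((i = i1 ∧ j = i2) ∨ (i = i3 ∧ j = i4))) ∧
  (∀ i j, M2.rel i j → ∃ i1 i2 i3 i4, IsTwoWaveQuad M1 M2 i1 i2 i3 i4 ∧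
      ((i = i2 ∧ j = i3) ∨ (i = i1 ∧ j = i4)))

/-- A 2-wave word. -/
def TwoNW.IsWaveWord {α : Type} (ω : TwoNW α) : Prop := IsWaveStructure ω.M1 ω.M2

/-- A 2-nested word automaton (2NWA); each transition table is presented as a
set of (input, output) pairs. -/
structure TwoNWA (α Q P : Type) where
  init : Set Q
  final : Set Q
  Δcc : Set ((Q × α) × (P × P × Q))
  Δrc : Set ((Q × P × α) × (P × Q))
  Δcr : Set ((Q × P × α) × (P × Q))
  Δrr : Set ((Q × P × P × α) × Q)
  Δci : Set ((Q × α) × (P × Q))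
  Δic : Set ((Q × α) × (P × Q))
  Δri : Set ((Q × P × α) × Q)
  Δir : Set ((Q × P × α) × Q)
  Δii : Set ((Q × α) × Q)

/-- The local run condition at position `i` (with `1 ≤ i ≤ |w|`): `ℓ` is the
sequence of linear states, and `h1 i` (resp. `h2 i`) is the hierarchical state
labelling the `M1`- (resp. `M2`-) arch whose call position is `i`. -/
def TwoNWA.RunAt {α Q P : Type} (A : TwoNWA α Q P) (ω : TwoNW α)
    (ℓ : ℕ → Q) (h1 h2 : ℕ → P) (i : ℕ) : Prop :=
  ∃ a, ω.word[i - 1]? = some a ∧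
    ((ω.M1.IsCall i ∧ ω.M2.IsCall i ∧ ((ℓ (i-1), a), (h1 i, h2 i, ℓ i)) ∈ A.Δcc)
   ∨ (∃ j, ω.M1.rel j i ∧ ω.M2.IsCall i ∧ ((ℓ (i-1), h1 j, a), (h2 i, ℓ i)) ∈ A.Δrc)
   ∨ (ω.M1.IsCall i ∧ (∃ j, ω.M2.rel j i ∧ ((ℓ (i-1), h2 j, a), (h1 i, ℓ i)) ∈ A.Δcr))
   ∨ (∃ j k, ω.M1.rel j i ∧ ω.M2.rel k i ∧ ((ℓ (i-1), h1 j, h2 k, a), ℓ i) ∈ A.Δrr)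
   ∨ (ω.M1.IsCall i ∧ ω.M2.IsInt i ∧ ((ℓ (i-1), a), (h1 i, ℓ i)) ∈ A.Δci)
   ∨ (ω.M1.IsInt i ∧ ω.M2.IsCall i ∧ ((ℓ (i-1), a), (h2 i, ℓ i)) ∈ A.Δic)
   ∨ (∃ j, ω.M1.rel j i ∧ ω.M2.IsInt i ∧ ((ℓ (i-1), h1 j, a), ℓ i) ∈ A.Δri)
   ∨ (ω.M1.IsInt i ∧ (∃ j, ω.M2.rel j i ∧ ((ℓ (i-1), h2 j, a), ℓ i) ∈ A.Δir))
   ∨ (ω.M1.IsInt i ∧ ω.M2.IsInt i ∧ ((ℓ (i-1), a), ℓ i) ∈ A.Δii))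

def TwoNWA.IsRun {α Q P : Type} (A : TwoNWA α Q P) (ω : TwoNW α)
    (ℓ : ℕ → Q) (h1 h2 : ℕ → P) : Prop :=
  ∀ i, 1 ≤ i → i ≤ ω.word.length → A.RunAt ω ℓ h1 h2 i

def TwoNWA.Accepts {α Q P : Type} (A : TwoNWA α Q P) (ω : TwoNW α) : Prop :=
  ∃ ℓ h1 h2, A.IsRun ω ℓ h1 h2 ∧ ℓ 0 ∈ A.init ∧ ℓ ω.word.length ∈ A.final

/-- The language of 2-nested words accepted by `A`. -/
def TwoNWA.lang {α Q P : Type} (A : TwoNWA α Q P) : Set (TwoNW α) :=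
  { ω | A.Accepts ω }

/-- The language of 2-wave words accepted by `A`. -/
def TwoNWA.langWW {α Q P : Type} (A : TwoNWA α Q P) : Set (TwoNW α) :=
  { ω | A.Accepts ω ∧ ω.IsWaveWord }

/-- There is a run of `A` on `ω` from linear state `q` to linear state `q'`. -/
def TwoNWA.Exec {α Q P : Type} (A : TwoNWA α Q P) (ω : TwoNW α) (q q' : Q) : Prop :=
  ∃ ℓ h1 h2, A.IsRun ω ℓ h1 h2 ∧ ℓ 0 = q ∧ ℓ ω.word.length = q'

/-- Deterministic 2NWA: a single initial state, and each transition table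
induces a function from inputs to outputs. -/
def TwoNWA.Deterministic {α Q P : Type} (A : TwoNWA α Q P) : Prop :=
  (∃ q0, A.init = {q0}) ∧
  (∀ x y y', (x, y) ∈ A.Δcc → (x, y') ∈ A.Δcc → y = y') ∧
  (∀ x y y', (x, y) ∈ A.Δrc → (x, y') ∈ A.Δrc → y = y') ∧
  (∀ x y y', (x, y) ∈ A.Δcr → (x, y') ∈ A.Δcr → y = y') ∧
  (∀ x y y', (x, y) ∈ A.Δrr → (x, y') ∈ A.Δrr → y = y') ∧
  (∀ x y y', (x, y) ∈ A.Δci → (x, y') ∈ A.Δci → y = y') ∧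
  (∀ x y y', (x, y) ∈ A.Δic → (x, y') ∈ A.Δic → y = y') ∧
  (∀ x y y', (x, y) ∈ A.Δri → (x, y') ∈ A.Δri → y = y') ∧
  (∀ x y y', (x, y) ∈ A.Δir → (x, y') ∈ A.Δir → y = y') ∧
  (∀ x y y', (x, y) ∈ A.Δii → (x, y') ∈ A.Δii → y = y')

/-- Complete 2NWA: each transition table provides an output for every input. -/
def TwoNWA.Complete {α Q P : Type} (A : TwoNWA α Q P) : Prop :=
  (∀ x, ∃ y, (x, y) ∈ A.Δcc) ∧ (∀ x, ∃ y, (x, y) ∈ A.Δrc) ∧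
  (∀ x, ∃ y, (x, y) ∈ A.Δcr) ∧ (∀ x, ∃ y, (x, y) ∈ A.Δrr) ∧
  (∀ x, ∃ y, (x, y) ∈ A.Δci) ∧ (∀ x, ∃ y, (x, y) ∈ A.Δic) ∧
  (∀ x, ∃ y, (x, y) ∈ A.Δri) ∧ (∀ x, ∃ y, (x, y) ∈ A.Δir) ∧
  (∀ x, ∃ y, (x, y) ∈ A.Δii)

/-- Weakly-hierarchical post form: hierarchical states are the linear states,
and every hierarchical output of a transition equals its target linear state. -/
def TwoNWA.PostForm {α Q : Type} (A : TwoNWA α Q Q) : Prop :=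
  (∀ t ∈ A.Δcc, t.2.1 = t.2.2.2 ∧ t.2.2.1 = t.2.2.2) ∧
  (∀ t ∈ A.Δrc, t.2.1 = t.2.2) ∧
  (∀ t ∈ A.Δcr, t.2.1 = t.2.2) ∧
  (∀ t ∈ A.Δci, t.2.1 = t.2.2) ∧
  (∀ t ∈ A.Δic, t.2.1 = t.2.2)

/-- Nice 2NWA: in every non-internal transition all hierarchical states
involved are equal. -/
def TwoNWA.Nice {α Q P : Type} (A : TwoNWA α Q P) : Prop :=
  (∀ t ∈ A.Δcc, t.2.1 = t.2.2.1) ∧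
  (∀ t ∈ A.Δrc, t.1.2.1 = t.2.1) ∧
  (∀ t ∈ A.Δcr, t.1.2.1 = t.2.1) ∧
  (∀ t ∈ A.Δrr, t.1.2.1 = t.1.2.2.1)

/-- A regular language of 2-nested words. -/
def RegularTwoNWL {α : Type} (L : Set (TwoNW α)) : Prop :=
  ∃ (Q P : Type) (_ : Finite Q) (_ : Finite P) (A : TwoNWA α Q P), A.lang = L

/-! ### Recursion principles -/

/-- The function defined by course-of-values recursion from `f`. -/
noncomputable def courseOfValues {β : Type} [Nonempty β] (f : ℕ → (ℕ → β) → β) (i : ℕ) : β :=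
  f i fun j => if _h : j < i then courseOfValues f j else Classical.arbitrary β
termination_by i

theorem exists_forward_rec {β : Type} [Nonempty β] (R : ℕ → (ℕ → β) → β → Prop)
    (hex : ∀ i g, ∃ b, R i g b)
    (hloc : ∀ i g g' b, (∀ j < i, g j = g' j) → R i g b → R i g' b) :
    ∃ G : ℕ → β, ∀ i, R i G (G i) := by
  choose f hf using hex
  refine ⟨courseOfValues f, fun i => ?_⟩
  rw [courseOfValues]
  refine hloc i _ _ _ (fun j hj => ?_) (hf i _)
  simp [hj]

theorem exists_backward_rec {β : Type} [Nonempty β] (n : ℕ) (R : ℕ → (ℕ → β) → β → Prop)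
    (hex : ∀ i g, ∃ b, R i g b)
    (hloc : ∀ i g g' b, (∀ j, i < j → j ≤ n → g j = g' j) → R i g b → R i g' b) :
    ∃ G : ℕ → β, ∀ i ≤ n, R i G (G i) := by
  obtain ⟨G, hG⟩ := exists_forward_rec
    (fun i g b => i ≤ n → R (n - i) (fun j => g (n - j)) b)
    (fun i g => (hex (n - i) _).imp fun b hb _ => hb)
    (fun i g g' b h hb hi => hloc _ _ _ _ (fun j h1 h2 => h _ (by omega)) (hb hi))
  refine ⟨fun j => G (n - j), fun i hi => ?_⟩
  simpa [Nat.sub_sub_self hi] using hG (n - i) (Nat.sub_le _ _)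

/-! ### The innermost open arch -/

namespace Matching

variable {n : ℕ} (M : Matching n)

open Classical in
/-- The call position of the innermost arch of `M` that is open just after position `i`,
or `0` if there is none. -/
noncomputable def top (i : ℕ) : ℕ := Nat.findGreatest (fun c => ∃ d, M.rel c d ∧ i < d) i

theorem top_eq_iff {i c : ℕ} : M.top i = c ↔ c ≤ i ∧ (c ≠ 0 → ∃ d, M.rel c d ∧ i < d) ∧
    ∀ c', c < c' → c' ≤ i → ∀ d, M.rel c' d → d ≤ i := by
  classical
  unfold top
  rw [Nat.findGreatest_eq_iff]
  simp only [not_exists, not_and, not_lt]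

theorem top_zero : M.top 0 = 0 := by
  simp [top]

theorem top_length : M.top n = 0 := by
  rw [top_eq_iff]
  exact ⟨Nat.zero_le _, fun h => absurd rfl h, fun c _ _ d h => (M.ordered _ _ h).2.2⟩

variable {M}

theorem top_call {i j : ℕ} (h : M.rel i j) : M.top i = i := by
  rw [top_eq_iff]
  exact ⟨le_rfl, fun _ => ⟨j, h, (M.ordered _ _ h).2.1⟩, fun c h1 h2 => by omega⟩

theorem top_pred_ret {i j : ℕ} (h : M.rel i j) : M.top (j - 1) = i := by
  have := M.ordered _ _ h
  rw [top_eq_iff]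
  refine ⟨by omega, fun _ => ⟨j, h, by omega⟩, fun c h1 h2 d hd => ?_⟩
  have := M.noncrossing _ _ _ _ h hd h1 (by omega)
  omega

theorem top_ret {i j : ℕ} (h : M.rel i j) : M.top j = M.top (i - 1) := by
  have hij := M.ordered _ _ h
  obtain ⟨h1, h2, h3⟩ := M.top_eq_iff.1 (rfl : M.top (i - 1) = _)
  rw [top_eq_iff]
  refine ⟨by omega, fun h0 => ?_, fun c hc hcj d hd => ?_⟩
  · obtain ⟨d, hd, hid⟩ := h2 h0
    refine ⟨d, hd, M.noncrossing _ _ _ _ hd h (by omega) ?_⟩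
    rcases Nat.lt_or_ge i d with h' | h'
    · exact h'
    · have := M.unique _ _ _ _ hd h (by omega)
      omega
  · by_contra hlt
    rcases Nat.lt_or_ge c i with hci | hci
    · have := h3 c hc (by omega) d hd
      omega
    · by_cases he : i = c ∨ j = c
      · have := M.unique _ _ _ _ h hd (by omega)
        omega
      · have := M.noncrossing _ _ _ _ h hd (by omega) (by omega)
        omega

theorem top_int {i : ℕ} (hi : 1 ≤ i) (h : M.IsInt i) : M.top i = M.top (i - 1) := by
  obtain ⟨h1, h2, h3⟩ := M.top_eq_iff.1 (rfl : M.top (i - 1) = _)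
  rw [top_eq_iff]
  refine ⟨by omega, fun h0 => ?_, fun c hc hci d hd => ?_⟩
  · obtain ⟨d, hd, hid⟩ := h2 h0
    refine ⟨d, hd, ?_⟩
    have : d ≠ i := fun e => h.2 ⟨_, e ▸ hd⟩
    omega
  · have : c ≠ i := fun e => h.1 ⟨_, e ▸ hd⟩
    have := h3 c hc (by omega) d hd
    omega

end Matching

/-! ### Structure of 2-wave words -/

namespace TwoNW

variable {α : Type} (ω : TwoNW α)

/-- `(k₁, k₂, k₃, k₄)` is a 2-wave of `ω`. -/
abbrev Wave (k₁ k₂ k₃ k₄ : ℕ) : Prop := IsTwoWaveQuad ω.M1 ω.M2 k₁ k₂ k₃ k₄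

/-- The position `i` of `ω` is internal for both matchings. -/
def Internal (i : ℕ) : Prop := 1 ≤ i ∧ i ≤ ω.word.length ∧ ω.M1.IsInt i ∧ ω.M2.IsInt i

variable {ω}

theorem Wave.bounds {k₁ k₂ k₃ k₄ : ℕ} (h : ω.Wave k₁ k₂ k₃ k₄) :
    1 ≤ k₁ ∧ k₁ < k₂ ∧ k₂ < k₃ ∧ k₃ < k₄ ∧ k₄ ≤ ω.word.length := by
  obtain ⟨h1, h2, h3, h4, h5, -, -⟩ := h
  exact ⟨(ω.M1.ordered _ _ h4).1, h1, h2, h3, (ω.M1.ordered _ _ h5).2.2⟩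

theorem Wave.eq {k₁ k₂ k₃ k₄ l₁ l₂ l₃ l₄ : ℕ} (h : ω.Wave k₁ k₂ k₃ k₄)
    (h' : ω.Wave l₁ l₂ l₃ l₄) (he : k₁ = l₁ ∨ k₂ = l₂ ∨ k₃ = l₃ ∨ k₄ = l₄) :
    k₁ = l₁ ∧ k₂ = l₂ ∧ k₃ = l₃ ∧ k₄ = l₄ := by
  obtain ⟨a1, a2, a3, a4, a5, a6, a7⟩ := h
  obtain ⟨b1, b2, b3, b4, b5, b6, b7⟩ := h'
  have e1 := ω.M1.unique _ _ _ _ a4 b4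
  have e2 := ω.M1.unique _ _ _ _ a5 b5
  have e3 := ω.M2.unique _ _ _ _ a6 b6
  have e4 := ω.M2.unique _ _ _ _ a7 b7
  omega

theorem Wave.ne {k₁ k₂ k₃ k₄ l₁ l₂ l₃ l₄ : ℕ} (h : ω.Wave k₁ k₂ k₃ k₄)
    (h' : ω.Wave l₁ l₂ l₃ l₄) :
    k₁ ≠ l₂ ∧ k₁ ≠ l₃ ∧ k₁ ≠ l₄ ∧ k₂ ≠ l₃ ∧ k₂ ≠ l₄ ∧ k₃ ≠ l₄ := by
  obtain ⟨a1, a2, a3, a4, a5, a6, a7⟩ := h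
  obtain ⟨b1, b2, b3, b4, b5, b6, b7⟩ := h'
  have e1 := ω.M1.unique _ _ _ _ a4 b4
  have e2 := ω.M1.unique _ _ _ _ a5 b5
  have e3 := ω.M2.unique _ _ _ _ a6 b6
  have e4 := ω.M2.unique _ _ _ _ a7 b7
  have e5 := ω.M1.unique _ _ _ _ a4 b5
  have e6 := ω.M2.unique _ _ _ _ a7 b6
  have e7 := ω.M2.unique _ _ _ _ a6 b7
  omega

theorem Internal.ne {i k₁ k₂ k₃ k₄ : ℕ} (hi : ω.Internal i) (h : ω.Wave k₁ k₂ k₃ k₄) :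
    i ≠ k₁ ∧ i ≠ k₂ ∧ i ≠ k₃ ∧ i ≠ k₄ := by
  obtain ⟨a1, a2, a3, a4, a5, a6, a7⟩ := h
  obtain ⟨-, -, ⟨h1, h2⟩, -⟩ := hi
  refine ⟨?_, ?_, ?_, ?_⟩ <;> rintro rfl
  exacts [h1 ⟨_, a4⟩, h2 ⟨_, a4⟩, h1 ⟨_, a5⟩, h2 ⟨_, a5⟩]

theorem IsWaveWord.position_cases (hw : ω.IsWaveWord) {i : ℕ} (h1 : 1 ≤ i)
    (h2 : i ≤ ω.word.length) : ω.Internal i ∨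
      ∃ k₁ k₂ k₃ k₄, ω.Wave k₁ k₂ k₃ k₄ ∧ (i = k₁ ∨ i = k₂ ∨ i = k₃ ∨ i = k₄) := by
  by_cases hi : ω.Internal i
  · exact Or.inl hi
  right
  have : (∃ j, ω.M1.rel i j ∨ ω.M1.rel j i) ∨ ∃ j, ω.M2.rel i j ∨ ω.M2.rel j i := by
    by_contra hc
    push Not at hc
    exact hi ⟨h1, h2, ⟨fun ⟨j, hj⟩ => (hc.1 j).1 hj, fun ⟨j, hj⟩ => (hc.1 j).2 hj⟩,
      ⟨fun ⟨j, hj⟩ => (hc.2 j).1 hj, fun ⟨j, hj⟩ => (hc.2 j).2 hj⟩⟩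
  rcases this with ⟨j, h | h⟩ | ⟨j, h | h⟩
  · obtain ⟨k₁, k₂, k₃, k₄, hk, _⟩ := hw.1 _ _ h
    exact ⟨k₁, k₂, k₃, k₄, hk, by omega⟩
  · obtain ⟨k₁, k₂, k₃, k₄, hk, _⟩ := hw.1 _ _ h
    exact ⟨k₁, k₂, k₃, k₄, hk, by omega⟩
  · obtain ⟨k₁, k₂, k₃, k₄, hk, _⟩ := hw.2 _ _ h
    exact ⟨k₁, k₂, k₃, k₄, hk, by omega⟩
  · obtain ⟨k₁, k₂, k₃, k₄, hk, _⟩ := hw.2 _ _ h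
    exact ⟨k₁, k₂, k₃, k₄, hk, by omega⟩

/-- A value attached to a position may be prescribed according to the role of the position
in its wave. -/
theorem exists_by_role {β : Type} [Nonempty β] (ω : TwoNW α) (i : ℕ) (x : β)
    (y₁ y₂ y₃ y₄ : ℕ → ℕ → ℕ → ℕ → β) :
    ∃ b, (ω.Internal i → b = x) ∧ ∀ k₁ k₂ k₃ k₄, ω.Wave k₁ k₂ k₃ k₄ →
      (i = k₁ → b = y₁ k₁ k₂ k₃ k₄) ∧ (i = k₂ → b = y₂ k₁ k₂ k₃ k₄) ∧
      (i = k₃ → b = y₃ k₁ k₂ k₃ k₄) ∧ (i = k₄ → b = y₄ k₁ k₂ k₃ k₄) := by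
  by_cases hi : ω.Internal i
  · refine ⟨x, fun _ => rfl, fun k₁ k₂ k₃ k₄ h => ?_⟩
    obtain ⟨h1, h2, h3, h4⟩ := hi.ne h
    exact ⟨fun h => absurd h h1, fun h => absurd h h2, fun h => absurd h h3,
      fun h => absurd h h4⟩
  by_cases hk : ∃ k₁ k₂ k₃ k₄, ω.Wave k₁ k₂ k₃ k₄ ∧ (i = k₁ ∨ i = k₂ ∨ i = k₃ ∨ i = k₄)
  · obtain ⟨l₁, l₂, l₃, l₄, hl, he⟩ := hk
    have key : ∀ k₁ k₂ k₃ k₄, ω.Wave k₁ k₂ k₃ k₄ →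
        (k₁ = l₁ ∨ k₂ = l₂ ∨ k₃ = l₃ ∨ k₄ = l₄ → k₁ = l₁ ∧ k₂ = l₂ ∧ k₃ = l₃ ∧ k₄ = l₄) ∧
        (l₁ ≠ k₂ ∧ l₁ ≠ k₃ ∧ l₁ ≠ k₄ ∧ l₂ ≠ k₃ ∧ l₂ ≠ k₄ ∧ l₃ ≠ k₄) ∧
        (k₁ ≠ l₂ ∧ k₁ ≠ l₃ ∧ k₁ ≠ l₄ ∧ k₂ ≠ l₃ ∧ k₂ ≠ l₄ ∧ k₃ ≠ l₄) :=
      fun _ _ _ _ h => ⟨h.eq hl, hl.ne h, h.ne hl⟩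
    rcases he with rfl | rfl | rfl | rfl
    · refine ⟨y₁ i l₂ l₃ l₄, fun h => absurd h hi, fun k₁ k₂ k₃ k₄ h => ?_⟩
      grind
    · refine ⟨y₂ l₁ i l₃ l₄, fun h => absurd h hi, fun k₁ k₂ k₃ k₄ h => ?_⟩
      grind
    · refine ⟨y₃ l₁ l₂ i l₄, fun h => absurd h hi, fun k₁ k₂ k₃ k₄ h => ?_⟩
      grind
    · refine ⟨y₄ l₁ l₂ l₃ i, fun h => absurd h hi, fun k₁ k₂ k₃ k₄ h => ?_⟩
      grind
  · refine ⟨Classical.arbitrary β, fun h => absurd h hi, fun k₁ k₂ k₃ k₄ h => ?_⟩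
    exact ⟨fun e => absurd ⟨_, _, _, _, h, by tauto⟩ hk, fun e => absurd ⟨_, _, _, _, h, by tauto⟩ hk,
      fun e => absurd ⟨_, _, _, _, h, by tauto⟩ hk, fun e => absurd ⟨_, _, _, _, h, by tauto⟩ hk⟩

/-- Waves are identified by their first position. There is a map `w` sending a position to the
wave (or `0`) of the innermost open arch of `M1`; it takes the same value at the two ends of
the middle part of a wave. -/
theorem IsWaveWord.exists_enclosing (hw : ω.IsWaveWord) : ∃ w : ℕ → ℕ,
    w 0 = 0 ∧ w ω.word.length = 0 ∧ (∀ i, ω.Internal i → w (i - 1) = w i) ∧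
    ∀ k₁ k₂ k₃ k₄, ω.Wave k₁ k₂ k₃ k₄ → w k₁ = k₁ ∧ w (k₂ - 1) = k₁ ∧ w k₂ = w (k₁ - 1) ∧
      w (k₃ - 1) = w (k₁ - 1) ∧ w k₃ = k₁ ∧ w (k₄ - 1) = k₁ ∧ w k₄ = w (k₁ - 1) := by
  have hd : ∀ c, ∃ k, (c = 0 → k = 0) ∧ ∀ k₁ k₂ k₃ k₄, ω.Wave k₁ k₂ k₃ k₄ →
      (c = k₁ → k = k₁) ∧ (c = k₃ → k = k₁) := by
    intro c
    rcases Nat.eq_zero_or_pos c with rfl | hc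
    · exact ⟨0, fun _ => rfl, fun k₁ k₂ k₃ k₄ h => by have := Wave.bounds h; omega⟩
    · obtain ⟨b, -, hb⟩ := exists_by_role ω c 0 (fun k _ _ _ => k) (fun k _ _ _ => k)
        (fun k _ _ _ => k) (fun k _ _ _ => k)
      exact ⟨b, fun h => by omega, fun k₁ k₂ k₃ k₄ h => ⟨(hb _ _ _ _ h).1, (hb _ _ _ _ h).2.2.1⟩⟩
  choose d hd0 hd using hd
  set w : ℕ → ℕ := fun i => d (ω.M1.top i) with hwdef
  have hint : ∀ i, ω.Internal i → w (i - 1) = w i := fun i hi => by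
    simp only [hwdef, Matching.top_int hi.1 hi.2.2.1]
  have basic : ∀ k₁ k₂ k₃ k₄, ω.Wave k₁ k₂ k₃ k₄ → w k₁ = k₁ ∧ w (k₂ - 1) = k₁ ∧
      w k₂ = w (k₁ - 1) ∧ w k₃ = k₁ ∧ w (k₄ - 1) = k₁ ∧ w k₄ = w (k₃ - 1) := by
    intro k₁ k₂ k₃ k₄ h
    have d3 := (hd k₃ _ _ _ _ h).2 rfl
    have d1 := (hd k₁ _ _ _ _ h).1 rfl
    obtain ⟨-, -, -, h12, h34, -, -⟩ := h
    simp only [hwdef, Matching.top_call h12, Matching.top_call h34, Matching.top_pred_ret h12,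
      Matching.top_pred_ret h34, Matching.top_ret h12, Matching.top_ret h34, d1, d3, and_self]
  have hw0 : w 0 = 0 := by simp only [hwdef, Matching.top_zero, hd0]
  -- The wave of the innermost open arch of `M1` is a function of that of `M2`.
  have hF : ∀ c, ∃ k, (c = 0 → k = 0) ∧ ∀ k₁ k₂ k₃ k₄, ω.Wave k₁ k₂ k₃ k₄ →
      (c = k₁ → k = k₁) ∧ (c = k₂ → k = w k₂) := by
    intro c
    rcases Nat.eq_zero_or_pos c with rfl | hc
    · exact ⟨0, fun _ => rfl, fun k₁ k₂ k₃ k₄ h => by have := Wave.bounds h; omega⟩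
    · obtain ⟨b, -, hb⟩ := exists_by_role ω c 0 (fun k _ _ _ => k) (fun _ k _ _ => w k)
        (fun k _ _ _ => k) (fun k _ _ _ => k)
      exact ⟨b, fun h => by omega, fun k₁ k₂ k₃ k₄ h => ⟨(hb _ _ _ _ h).1, (hb _ _ _ _ h).2.1⟩⟩
  choose F hF0 hF using hF
  have key : ∀ i ≤ ω.word.length, w i = F (ω.M2.top i) := by
    intro i
    induction i using Nat.strong_induction_on with
    | _ i ih =>
      intro hi
      rcases Nat.eq_zero_or_pos i with rfl | hpos
      · rw [hw0, Matching.top_zero, hF0 _ rfl]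
      rcases hw.position_cases hpos hi with h | ⟨k₁, k₂, k₃, k₄, h, hk⟩
      · rw [← hint i h, Matching.top_int h.1 h.2.2.2]
        exact ih _ (by omega) (by omega)
      obtain ⟨b1, b2, b3, b4, b5, b6⟩ := basic _ _ _ _ h
      have hb := Wave.bounds h
      have f1 := (hF k₁ _ _ _ _ h).1 rfl
      have f2 := (hF k₂ _ _ _ _ h).2 rfl
      obtain ⟨-, -, -, -, -, h23, h14⟩ := h
      rcases hk with rfl | rfl | rfl | rfl
      · rw [Matching.top_call h14, b1, f1]
      · rw [Matching.top_call h23, f2]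
      · rw [Matching.top_ret h23, b4, ← ih (k₂ - 1) (by omega) (by omega), b2]
      · rw [Matching.top_ret h14, b6, ← ih (k₁ - 1) (by omega) (by omega),
          ih (k₃ - 1) (by omega) (by omega), Matching.top_pred_ret h23, f2, b3]
  refine ⟨w, hw0, by simp only [hwdef, Matching.top_length, hd0], hint, fun k₁ k₂ k₃ k₄ h => ?_⟩
  obtain ⟨b1, b2, b3, b4, b5, b6⟩ := basic _ _ _ _ h
  have hb := Wave.bounds h
  have f2 := (hF k₂ _ _ _ _ h).2 rfl
  have : w (k₃ - 1) = w (k₁ - 1) := by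
    rw [key _ (by omega), Matching.top_pred_ret h.2.2.2.2.2.1, f2, b3]
  exact ⟨b1, b2, b3, this, b4, b5, b6.trans this⟩

end TwoNW

/-! ### Runs on 2-wave words -/

namespace TwoNWA

variable {α Q P : Type}

/-- The transition of a run at an internal position. -/
def InternalStep (A : TwoNWA α Q P) (ω : TwoNW α) (ℓ : ℕ → Q) (i : ℕ) : Prop :=
  ∃ a, ω.word[i - 1]? = some a ∧ ((ℓ (i - 1), a), ℓ i) ∈ A.Δii

/-- The four transitions of a run at the positions of a wave. -/
def WaveStep (A : TwoNWA α Q P) (ω : TwoNW α) (ℓ : ℕ → Q) (h1 h2 : ℕ → P)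
    (k₁ k₂ k₃ k₄ : ℕ) : Prop :=
  (∃ a, ω.word[k₁ - 1]? = some a ∧ ((ℓ (k₁ - 1), a), (h1 k₁, h2 k₁, ℓ k₁)) ∈ A.Δcc) ∧
  (∃ a, ω.word[k₂ - 1]? = some a ∧ ((ℓ (k₂ - 1), h1 k₁, a), (h2 k₂, ℓ k₂)) ∈ A.Δrc) ∧
  (∃ a, ω.word[k₃ - 1]? = some a ∧ ((ℓ (k₃ - 1), h2 k₂, a), (h1 k₃, ℓ k₃)) ∈ A.Δcr) ∧
  (∃ a, ω.word[k₄ - 1]? = some a ∧ ((ℓ (k₄ - 1), h1 k₃, h2 k₁, a), ℓ k₄) ∈ A.Δrr)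

theorem runAt_internal {A : TwoNWA α Q P} {ω : TwoNW α} {ℓ : ℕ → Q} {h1 h2 : ℕ → P} {i : ℕ}
    (hi : ω.Internal i) : A.RunAt ω ℓ h1 h2 i ↔ A.InternalStep ω ℓ i := by
  obtain ⟨-, -, hi1, hi2⟩ := hi
  have hc1 := hi1.1
  have hc2 := hi2.1
  have hr1 : ∀ j, ¬ ω.M1.rel j i := fun j h => hi1.2 ⟨j, h⟩
  have hr2 : ∀ j, ¬ ω.M2.rel j i := fun j h => hi2.2 ⟨j, h⟩
  simp [RunAt, InternalStep, hi1, hi2, hc1, hc2, hr1, hr2]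

theorem _root_.Matching.not_ret_of_call {n : ℕ} {M : Matching n} {i j : ℕ} (h : M.rel i j) (k : ℕ) :
    ¬ M.rel k i := fun h' => by
  have := M.unique _ _ _ _ h h' (by omega)
  have := M.ordered _ _ h
  omega

theorem _root_.Matching.rel_ret_iff {n : ℕ} {M : Matching n} {i j : ℕ} (h : M.rel i j) (k : ℕ) :
    M.rel k j ↔ k = i :=
  ⟨fun h' => (M.unique _ _ _ _ h' h (by omega)).1, fun e => e ▸ h⟩

theorem runAt_wave {A : TwoNWA α Q P} {ω : TwoNW α} {ℓ : ℕ → Q} {h1 h2 : ℕ → P}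
    {k₁ k₂ k₃ k₄ : ℕ} (h : ω.Wave k₁ k₂ k₃ k₄) :
    (A.RunAt ω ℓ h1 h2 k₁ ∧ A.RunAt ω ℓ h1 h2 k₂ ∧ A.RunAt ω ℓ h1 h2 k₃ ∧
      A.RunAt ω ℓ h1 h2 k₄) ↔ A.WaveStep ω ℓ h1 h2 k₁ k₂ k₃ k₄ := by
  obtain ⟨-, -, -, h12, h34, h23, h14⟩ := h
  have call : ∀ {n : ℕ} {M : Matching n} {i j : ℕ}, M.rel i j →
      M.IsCall i ∧ ¬ M.IsInt i ∧ ∀ k, ¬ M.rel k i := fun h =>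
    ⟨⟨_, h⟩, fun h' => h'.1 ⟨_, h⟩, Matching.not_ret_of_call h⟩
  have ret : ∀ {n : ℕ} {M : Matching n} {i j : ℕ}, M.rel i j →
      ¬ M.IsCall j ∧ ¬ M.IsInt j ∧ ∀ k, M.rel k j ↔ k = i := fun h =>
    ⟨fun ⟨_, h'⟩ => Matching.not_ret_of_call h' _ h, fun h' => h'.2 ⟨_, h⟩,
      Matching.rel_ret_iff h⟩
  have a1 := call h12
  have a2 := call h14
  have b1 := ret h12
  have b2 := call h23
  have c1 := call h34
  have c2 := ret h23
  have d1 := ret h34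
  have d2 := ret h14
  refine and_congr ?_ (and_congr ?_ (and_congr ?_ ?_))
  · simp [RunAt, a1, a2]
  · simp [RunAt, b1, b2]
  · simp [RunAt, c1, c2]
  · simp [RunAt, d1, d2]

theorem isRun_iff {A : TwoNWA α Q P} {ω : TwoNW α} (hw : ω.IsWaveWord) {ℓ : ℕ → Q}
    {h1 h2 : ℕ → P} : A.IsRun ω ℓ h1 h2 ↔ (∀ i, ω.Internal i → A.InternalStep ω ℓ i) ∧
      ∀ k₁ k₂ k₃ k₄, ω.Wave k₁ k₂ k₃ k₄ → A.WaveStep ω ℓ h1 h2 k₁ k₂ k₃ k₄ := by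
  constructor
  · refine fun h => ⟨fun i hi => (runAt_internal hi).1 (h i hi.1 hi.2.1),
      fun k₁ k₂ k₃ k₄ hk => (runAt_wave hk).1 ?_⟩
    have := TwoNW.Wave.bounds hk
    exact ⟨h _ (by omega) (by omega), h _ (by omega) (by omega), h _ (by omega) (by omega),
      h _ (by omega) (by omega)⟩
  · rintro ⟨hint, hwave⟩ i hi1 hi2
    rcases hw.position_cases hi1 hi2 with h | ⟨k₁, k₂, k₃, k₄, h, hk⟩
    · exact (runAt_internal h).2 (hint i h)
    · have := (runAt_wave h).2 (hwave _ _ _ _ h)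
      rcases hk with rfl | rfl | rfl | rfl
      exacts [this.1, this.2.1, this.2.2.1, this.2.2.2]

/-! ### The deterministic automaton -/

/-- A guess about the run along a wave `(k₁, k₂, k₃, k₄)`: the linear states after `k₂` and
before `k₃`, and the labels of the arches `(k₁, k₂)`, `(k₁, k₄)`, `(k₂, k₃)`, `(k₃, k₄)`. -/
@[ext] structure Guess (Q P : Type) where
  after₂ : Q
  before₃ : Q
  lab₁₂ : P
  lab₁₄ : P
  lab₂₃ : P
  lab₃₄ : P

instance [Finite Q] [Finite P] : Finite (Guess Q P) :=
  Finite.of_injective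
    (fun g : Guess Q P => (g.after₂, g.before₃, g.lab₁₂, g.lab₁₄, g.lab₂₃, g.lab₃₄))
    fun g g' h => by
      simp only [Prod.mk.injEq] at h
      exact Guess.ext h.1 h.2.1 h.2.2.1 h.2.2.2.1 h.2.2.2.2.1 h.2.2.2.2.2

/-- A summary collects triples `(g, s, q)`: assuming the guess `g` for the wave of the innermost
open arch of `M1`, the automaton can go from `s`, the linear state at the call of the innermost
open arch of `M2`, to `q`, the current linear state. -/
abbrev Summary (Q P : Type) : Type := Set (Guess Q P × Q × Q)

/-- The summary of an empty stretch. -/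
def Summary.refl : Summary Q P := {t | t.2.1 = t.2.2}

variable (A : TwoNWA α Q P)

/-- The effect of an internal position on a summary. -/
def stepInt (T : Summary Q P) (o : Option α) : Summary Q P :=
  {t | ∃ a q, o = some a ∧ (t.1, t.2.1, q) ∈ T ∧ ((q, a), t.2.2) ∈ A.Δii}

/-- The summary after the third position of a wave, from the summary `T` before the second
position and the letters at these two positions. -/
def stepThird (T : Summary Q P) (o₂ o₃ : Option α) : Summary Q P :=
  {t | ∃ a₂ a₃ q, o₂ = some a₂ ∧ o₃ = some a₃ ∧ (t.1, t.2.1, q) ∈ T ∧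
    ((q, t.1.lab₁₂, a₂), (t.1.lab₂₃, t.1.after₂)) ∈ A.Δrc ∧
    ((t.1.before₃, t.1.lab₂₃, a₃), (t.1.lab₃₄, t.2.2)) ∈ A.Δcr}

/-- The summary after the fourth position of a wave, from the summaries `T₁`, `T₃`, `T₄` before
the first, third and fourth positions and the letters at the first and fourth positions. -/
def stepFourth (T₁ T₃ T₄ : Summary Q P) (o₁ o₄ : Option α) : Summary Q P :=
  {t | ∃ a₁ a₄ g q₁ r q₄, o₁ = some a₁ ∧ o₄ = some a₄ ∧ (t.1, t.2.1, q₁) ∈ T₁ ∧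
    (t.1, g.after₂, g.before₃) ∈ T₃ ∧ (g, r, q₄) ∈ T₄ ∧
    ((q₁, a₁), (g.lab₁₂, g.lab₁₄, r)) ∈ A.Δcc ∧ ((q₄, g.lab₃₄, g.lab₁₄, a₄), t.2.2) ∈ A.Δrr}

/-- The automaton computing summaries; on the arches it records the summary before the call
together with the letter at the call. -/
def determinize : TwoNWA α (Summary Q P) (Summary Q P × Option α) where
  init := {Summary.refl}
  final := {T | ∃ t ∈ T, t.2.1 ∈ A.init ∧ t.2.2 ∈ A.final}
  Δcc := {x | x.2 = ((x.1.1, some x.1.2), (x.1.1, some x.1.2), Summary.refl)}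
  Δrc := {x | x.2 = ((x.1.1, some x.1.2.2), Summary.refl)}
  Δcr := {x | x.2 = ((x.1.1, some x.1.2.2),
    A.stepThird x.1.2.1.1 x.1.2.1.2 (some x.1.2.2))}
  Δrr := {x | x.2 = A.stepFourth x.1.2.2.1.1 x.1.2.1.1 x.1.1 x.1.2.2.1.2 (some x.1.2.2.2)}
  Δci := ∅
  Δic := ∅
  Δri := ∅
  Δir := ∅
  Δii := {x | x.2 = A.stepInt x.1.1 (some x.1.2)}

theorem determinize_deterministic : A.determinize.Deterministic := by
  refine ⟨⟨_, rfl⟩, ?_, ?_, ?_, ?_, fun _ _ _ h => h.elim, fun _ _ _ h => h.elim,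
    fun _ _ _ h => h.elim, fun _ _ _ h => h.elim, ?_⟩ <;>
  exact fun x y y' (h : y = _) (h' : y' = _) => h.trans h'.symm

/-- `T` is the sequence of summaries computed along `ω`. -/
structure IsSummarySeq (ω : TwoNW α) (T : ℕ → Summary Q P) : Prop where
  zero : T 0 = Summary.refl
  internal : ∀ i, ω.Internal i → T i = A.stepInt (T (i - 1)) ω.word[i - 1]?
  wave : ∀ k₁ k₂ k₃ k₄, ω.Wave k₁ k₂ k₃ k₄ → T k₁ = Summary.refl ∧ T k₂ = Summary.refl ∧
    T k₃ = A.stepThird (T (k₂ - 1)) ω.word[k₂ - 1]? ω.word[k₃ - 1]? ∧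
    T k₄ = A.stepFourth (T (k₁ - 1)) (T (k₃ - 1)) (T (k₄ - 1)) ω.word[k₁ - 1]? ω.word[k₄ - 1]?

theorem exists_isSummarySeq (ω : TwoNW α) : ∃ T, A.IsSummarySeq ω T := by
  obtain ⟨T, hT⟩ := exists_forward_rec (β := Summary Q P)
    (fun i T S => (i = 0 → S = Summary.refl) ∧
      (ω.Internal i → S = A.stepInt (T (i - 1)) ω.word[i - 1]?) ∧
      ∀ k₁ k₂ k₃ k₄, ω.Wave k₁ k₂ k₃ k₄ → (i = k₁ → S = Summary.refl) ∧
        (i = k₂ → S = Summary.refl) ∧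
        (i = k₃ → S = A.stepThird (T (k₂ - 1)) ω.word[k₂ - 1]? ω.word[k₃ - 1]?) ∧
        (i = k₄ → S = A.stepFourth (T (k₁ - 1)) (T (k₃ - 1)) (T (k₄ - 1)) ω.word[k₁ - 1]?
          ω.word[k₄ - 1]?))
    (by
      intro i T
      rcases Nat.eq_zero_or_pos i with rfl | hi
      · refine ⟨Summary.refl, fun _ => rfl, fun h => absurd h.1 (by omega), fun k₁ k₂ k₃ k₄ h => ?_⟩
        have := TwoNW.Wave.bounds h
        refine ⟨?_, ?_, ?_, ?_⟩ <;> intro e <;> omega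
      · obtain ⟨S, hS1, hS2⟩ := TwoNW.exists_by_role ω i
          (A.stepInt (T (i - 1)) ω.word[i - 1]?) (fun _ _ _ _ => Summary.refl)
          (fun _ _ _ _ => Summary.refl)
          (fun _ k₂ k₃ _ => A.stepThird (T (k₂ - 1)) ω.word[k₂ - 1]? ω.word[k₃ - 1]?)
          (fun k₁ _ k₃ k₄ => A.stepFourth (T (k₁ - 1)) (T (k₃ - 1)) (T (k₄ - 1))
            ω.word[k₁ - 1]? ω.word[k₄ - 1]?)
        exact ⟨S, fun h => by omega, hS1, hS2⟩)
    (by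
      rintro i T T' S hTT ⟨h0, h1, h2⟩
      refine ⟨h0, fun hi => ?_, fun k₁ k₂ k₃ k₄ h => ?_⟩
      · rw [h1 hi, hTT _ (by have := hi.1; omega)]
      · obtain ⟨e1, e2, e3, e4⟩ := h2 _ _ _ _ h
        have := TwoNW.Wave.bounds h
        refine ⟨e1, e2, fun e => ?_, fun e => ?_⟩
        · rw [e3 e, hTT _ (by omega)]
        · rw [e4 e, hTT _ (by omega), hTT _ (by omega), hTT _ (by omega)])
  exact ⟨T, (hT 0).1 rfl, fun i => (hT i).2.1, fun k₁ k₂ k₃ k₄ h =>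
    ⟨((hT k₁).2.2 _ _ _ _ h).1 rfl, ((hT k₂).2.2 _ _ _ _ h).2.1 rfl,
      ((hT k₃).2.2 _ _ _ _ h).2.2.1 rfl, ((hT k₄).2.2 _ _ _ _ h).2.2.2 rfl⟩⟩

theorem determinize_accepts_iff {ω : TwoNW α} (hw : ω.IsWaveWord) :
    A.determinize.Accepts ω ↔
      ∃ T, A.IsSummarySeq ω T ∧ ∃ t ∈ T ω.word.length, t.2.1 ∈ A.init ∧ t.2.2 ∈ A.final := by
  constructor
  · rintro ⟨T, h1, h2, hrun, h0, hfin⟩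
    rw [isRun_iff hw] at hrun
    refine ⟨T, ⟨h0, fun i hi => ?_, fun k₁ k₂ k₃ k₄ hk => ?_⟩, hfin⟩
    · obtain ⟨a, ha, h⟩ := hrun.1 i hi
      rw [ha]
      exact h
    · obtain ⟨⟨a₁, e1, r1⟩, ⟨a₂, e2, r2⟩, ⟨a₃, e3, r3⟩, ⟨a₄, e4, r4⟩⟩ := hrun.2 _ _ _ _ hk
      simp only [determinize, Set.mem_ofPred_eq, Prod.mk.injEq] at r1 r2 r3 r4
      refine ⟨r1.2.2, r2.2, ?_, ?_⟩
      · rw [r3.2, r2.1, e2, e3]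
      · rw [r4, r1.2.1, r3.1, e1, e4]
  · rintro ⟨T, hT, hfin⟩
    refine ⟨T, fun i => (T (i - 1), ω.word[i - 1]?), fun i => (T (i - 1), ω.word[i - 1]?),
      (isRun_iff hw).2 ⟨fun i hi => ?_, fun k₁ k₂ k₃ k₄ hk => ?_⟩, hT.zero, hfin⟩
    · have letter : ∃ a, ω.word[i - 1]? = some a :=
        ⟨_, List.getElem?_eq_getElem (by have := hi.1; have := hi.2.1; omega)⟩
      obtain ⟨a, ha⟩ := letter
      refine ⟨a, ha, ?_⟩
      simp only [determinize, Set.mem_ofPred_eq]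
      rw [hT.internal i hi, ha]
    · have hb := TwoNW.Wave.bounds hk
      have letter : ∀ i, 1 ≤ i → i ≤ ω.word.length → ∃ a, ω.word[i - 1]? = some a :=
        fun i h1 h2 => ⟨_, List.getElem?_eq_getElem (by omega)⟩
      obtain ⟨a₁, e1⟩ := letter k₁ (by omega) (by omega)
      obtain ⟨a₂, e2⟩ := letter k₂ (by omega) (by omega)
      obtain ⟨a₃, e3⟩ := letter k₃ (by omega) (by omega)
      obtain ⟨a₄, e4⟩ := letter k₄ (by omega) (by omega)
      obtain ⟨r1, r2, r3, r4⟩ := hT.wave _ _ _ _ hk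
      refine ⟨⟨a₁, e1, ?_⟩, ⟨a₂, e2, ?_⟩, ⟨a₃, e3, ?_⟩, ⟨a₄, e4, ?_⟩⟩ <;>
        simp only [determinize, Set.mem_ofPred_eq, Prod.mk.injEq]
      · simp [e1, r1]
      · simp [e2, r2]
      · simp [e2, e3, r3]
      · simp [e1, e4, r4]

/-! ### Correctness -/

variable {A}

theorem IsSummarySeq.complete {ω : TwoNW α} (hw : ω.IsWaveWord) {T : ℕ → Summary Q P}
    (hT : A.IsSummarySeq ω T) {ℓ : ℕ → Q} {h1 h2 : ℕ → P} (hrun : A.IsRun ω ℓ h1 h2) :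
    ∃ g, (g, ℓ 0, ℓ ω.word.length) ∈ T ω.word.length := by
  obtain ⟨w, -, -, wint, wwave⟩ := hw.exists_enclosing
  obtain ⟨rint, rwave⟩ := (isRun_iff hw).1 hrun
  let val : ℕ → ℕ → ℕ → ℕ → Guess Q P := fun k₁ k₂ k₃ _ =>
    ⟨ℓ k₂, ℓ (k₃ - 1), h1 k₁, h2 k₁, h2 k₂, h1 k₃⟩
  have hg : ∀ k, ∃ g, ∀ k₁ k₂ k₃ k₄, ω.Wave k₁ k₂ k₃ k₄ → k = k₁ → g = val k₁ k₂ k₃ k₄ := by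
    intro k
    have : Nonempty (Guess Q P) := ⟨val 0 0 0 0⟩
    obtain ⟨g, -, hg⟩ := TwoNW.exists_by_role ω k (val 0 0 0 0) val val val val
    exact ⟨g, fun _ _ _ _ h => (hg _ _ _ _ h).1⟩
  choose g hg using hg
  have key : ∀ i ≤ ω.word.length, (g (w i), ℓ (ω.M2.top i), ℓ i) ∈ T i := by
    intro i
    induction i using Nat.strong_induction_on with
    | _ i ih =>
      intro hi
      rcases Nat.eq_zero_or_pos i with rfl | hpos
      · rw [hT.zero, Matching.top_zero]
        rfl
      rcases hw.position_cases hpos hi with h | ⟨k₁, k₂, k₃, k₄, h, hk⟩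
      · obtain ⟨a, ha, hstep⟩ := rint i h
        rw [hT.internal i h, Matching.top_int h.1 h.2.2.2, ← wint i h]
        exact ⟨a, _, ha, ih _ (by omega) (by omega), hstep⟩
      have hb := TwoNW.Wave.bounds h
      obtain ⟨t1, t2, t3, t4⟩ := hT.wave _ _ _ _ h
      obtain ⟨w1, w2, w3, w4, w5, w6, w7⟩ := wwave _ _ _ _ h
      obtain ⟨⟨a₁, e1, r1⟩, ⟨a₂, e2, r2⟩, ⟨a₃, e3, r3⟩, ⟨a₄, e4, r4⟩⟩ := rwave _ _ _ _ h
      have hgk := hg _ _ _ _ _ h rfl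
      obtain ⟨-, -, -, -, -, h23, h14⟩ := h
      rcases hk with rfl | rfl | rfl | rfl
      · rw [t1, Matching.top_call h14]
        rfl
      · rw [t2, Matching.top_call h23]
        rfl
      · have i2 := ih (k₂ - 1) (by omega) (by omega)
        rw [w2] at i2
        rw [t3, Matching.top_ret h23, w5]
        refine ⟨a₂, a₃, _, e2, e3, i2, ?_⟩
        rw [hgk]
        exact ⟨r2, r3⟩
      · have i1 := ih (k₁ - 1) (by omega) (by omega)
        have i3 := ih (k₃ - 1) (by omega) (by omega)
        have i4 := ih (i - 1) (by omega) (by omega)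
        rw [w4, Matching.top_pred_ret h23] at i3
        rw [w6, Matching.top_pred_ret h14, hgk] at i4
        rw [t4, Matching.top_ret h14, w7]
        exact ⟨a₁, a₄, _, _, _, _, e1, e4, i1, i3, i4, r1, r4⟩
  have := key _ le_rfl
  rw [Matching.top_length] at this
  exact ⟨_, this⟩

/-- Every triple of the last summary can be traced back through all summaries. -/
theorem IsSummarySeq.exists_trace {ω : TwoNW α} (hw : ω.IsWaveWord) {T : ℕ → Summary Q P}
    (hT : A.IsSummarySeq ω T) {t : Guess Q P × Q × Q} (ht : t ∈ T ω.word.length) :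
    ∃ G : ℕ → Guess Q P × Q × Q, G ω.word.length = t ∧ (∀ i ≤ ω.word.length, G i ∈ T i) ∧
      (∀ i, ω.Internal i → (G (i - 1)).1 = (G i).1 ∧ (G (i - 1)).2.1 = (G i).2.1 ∧
        ∃ a, ω.word[i - 1]? = some a ∧ (((G (i - 1)).2.2, a), (G i).2.2) ∈ A.Δii) ∧
      ∀ k₁ k₂ k₃ k₄, ω.Wave k₁ k₂ k₃ k₄ →
        ((G (k₂ - 1)).1 = (G k₃).1 ∧ (G (k₂ - 1)).2.1 = (G k₃).2.1 ∧
          ∃ a₂ a₃, ω.word[k₂ - 1]? = some a₂ ∧ ω.word[k₃ - 1]? = some a₃ ∧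
            (((G (k₂ - 1)).2.2, (G k₃).1.lab₁₂, a₂), ((G k₃).1.lab₂₃, (G k₃).1.after₂)) ∈ A.Δrc ∧
            (((G k₃).1.before₃, (G k₃).1.lab₂₃, a₃), ((G k₃).1.lab₃₄, (G k₃).2.2)) ∈ A.Δcr) ∧
        (G (k₁ - 1)).1 = (G k₄).1 ∧ (G (k₁ - 1)).2.1 = (G k₄).2.1 ∧
        G (k₃ - 1) = ((G k₄).1, (G (k₄ - 1)).1.after₂, (G (k₄ - 1)).1.before₃) ∧
        ∃ a₁ a₄, ω.word[k₁ - 1]? = some a₁ ∧ ω.word[k₄ - 1]? = some a₄ ∧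
          (((G (k₁ - 1)).2.2, a₁), ((G (k₄ - 1)).1.lab₁₂, (G (k₄ - 1)).1.lab₁₄,
            (G (k₄ - 1)).2.1)) ∈ A.Δcc ∧
          (((G (k₄ - 1)).2.2, (G (k₄ - 1)).1.lab₃₄, (G (k₄ - 1)).1.lab₁₄, a₄),
            (G k₄).2.2) ∈ A.Δrr := by
  have : Nonempty (Guess Q P × Q × Q) := ⟨t⟩
  have hint : ∀ i u, ∃ v : Guess Q P × Q × Q, ω.Internal i → u ∈ T i →
      v ∈ T (i - 1) ∧ v.1 = u.1 ∧ v.2.1 = u.2.1 ∧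
        ∃ a, ω.word[i - 1]? = some a ∧ ((v.2.2, a), u.2.2) ∈ A.Δii := by
    intro i u
    by_cases h : ω.Internal i ∧ u ∈ T i
    · obtain ⟨hi, hu⟩ := h
      rw [hT.internal i hi] at hu
      obtain ⟨a, q, ha, hq, hstep⟩ := hu
      exact ⟨_, fun _ _ => ⟨hq, rfl, rfl, a, ha, hstep⟩⟩
    · exact ⟨u, fun h1 h2 => absurd ⟨h1, h2⟩ h⟩
  have hthird : ∀ k₁ k₂ k₃ k₄ u, ∃ v : Guess Q P × Q × Q, ω.Wave k₁ k₂ k₃ k₄ → u ∈ T k₃ →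
      v ∈ T (k₂ - 1) ∧ v.1 = u.1 ∧ v.2.1 = u.2.1 ∧
        ∃ a₂ a₃, ω.word[k₂ - 1]? = some a₂ ∧ ω.word[k₃ - 1]? = some a₃ ∧
          ((v.2.2, u.1.lab₁₂, a₂), (u.1.lab₂₃, u.1.after₂)) ∈ A.Δrc ∧
          ((u.1.before₃, u.1.lab₂₃, a₃), (u.1.lab₃₄, u.2.2)) ∈ A.Δcr := by
    intro k₁ k₂ k₃ k₄ u
    by_cases h : ω.Wave k₁ k₂ k₃ k₄ ∧ u ∈ T k₃
    · obtain ⟨hk, hu⟩ := h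
      rw [(hT.wave _ _ _ _ hk).2.2.1] at hu
      obtain ⟨a₂, a₃, q, h2, h3, hq, hs⟩ := hu
      exact ⟨_, fun _ _ => ⟨hq, rfl, rfl, a₂, a₃, h2, h3, hs⟩⟩
    · exact ⟨u, fun h1 h2 => absurd ⟨h1, h2⟩ h⟩
  have hfourth : ∀ k₁ k₂ k₃ k₄ u, ∃ v₁ v₃ v₄ : Guess Q P × Q × Q,
      ω.Wave k₁ k₂ k₃ k₄ → u ∈ T k₄ →
        v₁ ∈ T (k₁ - 1) ∧ v₃ ∈ T (k₃ - 1) ∧ v₄ ∈ T (k₄ - 1) ∧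
        v₁.1 = u.1 ∧ v₁.2.1 = u.2.1 ∧ v₃ = (u.1, v₄.1.after₂, v₄.1.before₃) ∧
        ∃ a₁ a₄, ω.word[k₁ - 1]? = some a₁ ∧ ω.word[k₄ - 1]? = some a₄ ∧
          ((v₁.2.2, a₁), (v₄.1.lab₁₂, v₄.1.lab₁₄, v₄.2.1)) ∈ A.Δcc ∧
          ((v₄.2.2, v₄.1.lab₃₄, v₄.1.lab₁₄, a₄), u.2.2) ∈ A.Δrr := by
    intro k₁ k₂ k₃ k₄ u
    by_cases h : ω.Wave k₁ k₂ k₃ k₄ ∧ u ∈ T k₄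
    · obtain ⟨hk, hu⟩ := h
      rw [(hT.wave _ _ _ _ hk).2.2.2] at hu
      obtain ⟨a₁, a₄, g, q₁, r, q₄, h1, h4, hq1, hm, hq4, hs1, hs4⟩ := hu
      exact ⟨_, _, (g, r, q₄), fun _ _ =>
        ⟨hq1, hm, hq4, rfl, rfl, rfl, a₁, a₄, h1, h4, hs1, hs4⟩⟩
    · exact ⟨u, u, u, fun h1 h2 => absurd ⟨h1, h2⟩ h⟩
  choose f hf using hint
  choose f₂ hf₂ using hthird
  choose f₁ f₃ f₄ hf₄ using hfourth
  obtain ⟨G, hG⟩ := exists_backward_rec ω.word.length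
    (fun i G v => (i = ω.word.length → v = t) ∧ (i < ω.word.length →
      (ω.Internal (i + 1) → v = f (i + 1) (G (i + 1))) ∧
      ∀ k₁ k₂ k₃ k₄, ω.Wave k₁ k₂ k₃ k₄ →
        (i + 1 = k₁ → v = f₁ k₁ k₂ k₃ k₄ (G k₄)) ∧ (i + 1 = k₂ → v = f₂ k₁ k₂ k₃ k₄ (G k₃)) ∧
        (i + 1 = k₃ → v = f₃ k₁ k₂ k₃ k₄ (G k₄)) ∧ (i + 1 = k₄ → v = f₄ k₁ k₂ k₃ k₄ (G k₄))))
    (by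
      intro i G
      by_cases hi : i = ω.word.length
      · exact ⟨t, fun _ => rfl, fun h => by omega⟩
      · obtain ⟨v, hv⟩ := TwoNW.exists_by_role ω (i + 1) (f (i + 1) (G (i + 1)))
          (fun k₁ k₂ k₃ k₄ => f₁ k₁ k₂ k₃ k₄ (G k₄)) (fun k₁ k₂ k₃ k₄ => f₂ k₁ k₂ k₃ k₄ (G k₃))
          (fun k₁ k₂ k₃ k₄ => f₃ k₁ k₂ k₃ k₄ (G k₄)) (fun k₁ k₂ k₃ k₄ => f₄ k₁ k₂ k₃ k₄ (G k₄))
        exact ⟨v, fun h => absurd h hi, fun _ => hv⟩)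
    (by
      rintro i G G' v hGG ⟨h0, h1⟩
      refine ⟨h0, fun hi => ⟨fun h => ?_, fun k₁ k₂ k₃ k₄ h => ?_⟩⟩
      · rw [← hGG _ (by omega) (by omega)]
        exact (h1 hi).1 h
      · have hb := TwoNW.Wave.bounds h
        obtain ⟨e1, e2, e3, e4⟩ := (h1 hi).2 _ _ _ _ h
        refine ⟨fun e => ?_, fun e => ?_, fun e => ?_, fun e => ?_⟩
        · rw [← hGG _ (by omega) (by omega)]
          exact e1 e
        · rw [← hGG _ (by omega) (by omega)]
          exact e2 e
        · rw [← hGG _ (by omega) (by omega)]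
          exact e3 e
        · rw [← hGG _ (by omega) (by omega)]
          exact e4 e)
  have Gint : ∀ i, ω.Internal i → G (i - 1) = f i (G i) := by
    intro i hi
    obtain ⟨h1, h2, -⟩ := id hi
    have := ((hG (i - 1) (by omega)).2 (by omega)).1
    rw [Nat.sub_add_cancel h1] at this
    exact this hi
  have Gwave : ∀ k₁ k₂ k₃ k₄, ω.Wave k₁ k₂ k₃ k₄ →
      G (k₁ - 1) = f₁ k₁ k₂ k₃ k₄ (G k₄) ∧ G (k₂ - 1) = f₂ k₁ k₂ k₃ k₄ (G k₃) ∧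
      G (k₃ - 1) = f₃ k₁ k₂ k₃ k₄ (G k₄) ∧ G (k₄ - 1) = f₄ k₁ k₂ k₃ k₄ (G k₄) := by
    intro k₁ k₂ k₃ k₄ h
    have hb := TwoNW.Wave.bounds h
    have := fun i (hi : i < ω.word.length) => ((hG i hi.le).2 hi).2 _ _ _ _ h
    exact ⟨(this (k₁ - 1) (by omega)).1 (by omega), (this (k₂ - 1) (by omega)).2.1 (by omega),
      (this (k₃ - 1) (by omega)).2.2.1 (by omega), (this (k₄ - 1) (by omega)).2.2.2 (by omega)⟩
  have Gn : G ω.word.length = t := (hG _ le_rfl).1 rfl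
  have mem : ∀ m i, i + m = ω.word.length → G i ∈ T i := by
    intro m
    induction m using Nat.strong_induction_on with
    | _ m ih =>
      intro i him
      rcases Nat.eq_zero_or_pos m with rfl | hm
      · have : i = ω.word.length := by omega
        rw [this, Gn]
        exact ht
      have next : ∀ j, i < j → j ≤ ω.word.length → G j ∈ T j := fun j h1 h2 =>
        ih (ω.word.length - j) (by omega) j (by omega)
      obtain ⟨j, rfl, hj⟩ : ∃ j, i = j - 1 ∧ 1 ≤ j := ⟨i + 1, rfl, by omega⟩
      rcases hw.position_cases hj (by omega) with h | ⟨k₁, k₂, k₃, k₄, h, hk⟩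
      · rw [Gint j h]
        exact (hf _ _ h (next _ (by omega) (by omega))).1
      have hb := TwoNW.Wave.bounds h
      obtain ⟨e1, e2, e3, e4⟩ := Gwave _ _ _ _ h
      have m4 := hf₄ _ _ _ _ _ h (next k₄ (by omega) (by omega))
      rcases hk with rfl | rfl | rfl | rfl
      · rw [e1]
        exact m4.1
      · rw [e2]
        exact (hf₂ _ _ _ _ _ h (next k₃ (by omega) (by omega))).1
      · rw [e3]
        exact m4.2.1
      · rw [e4]
        exact m4.2.2.1
  have mem : ∀ i ≤ ω.word.length, G i ∈ T i := fun i hi =>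
    mem (ω.word.length - i) i (by omega)
  refine ⟨G, Gn, mem, fun i hi => ?_, fun k₁ k₂ k₃ k₄ h => ?_⟩
  · rw [Gint i hi]
    exact (hf _ _ hi (mem i hi.2.1)).2
  · have hb := TwoNW.Wave.bounds h
    obtain ⟨e1, e2, e3, e4⟩ := Gwave _ _ _ _ h
    rw [e1, e2, e3, e4]
    exact ⟨(hf₂ _ _ _ _ _ h (mem k₃ (by omega))).2,
      (hf₄ _ _ _ _ _ h (mem k₄ (by omega))).2.2.2⟩

theorem IsSummarySeq.sound {ω : TwoNW α} (hw : ω.IsWaveWord) {T : ℕ → Summary Q P}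
    (hT : A.IsSummarySeq ω T) {t : Guess Q P × Q × Q} (ht : t ∈ T ω.word.length) :
    ∃ ℓ h1 h2, A.IsRun ω ℓ h1 h2 ∧ ℓ 0 = t.2.1 ∧ ℓ ω.word.length = t.2.2 := by
  obtain ⟨G, Gn, mem, Gint, Gwave⟩ := hT.exists_trace hw ht
  obtain ⟨w, -, wn, wint, wwave⟩ := hw.exists_enclosing
  have : Nonempty Q := ⟨t.2.1⟩
  have : Nonempty P := ⟨t.1.lab₁₂⟩
  have : Nonempty (Guess Q P) := ⟨t.1⟩
  have hH : ∀ k, ∃ g, (k = 0 → g = t.1) ∧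
      ∀ k₁ k₂ k₃ k₄, ω.Wave k₁ k₂ k₃ k₄ → k = k₁ → g = (G (k₄ - 1)).1 := by
    intro k
    rcases Nat.eq_zero_or_pos k with rfl | hk
    · exact ⟨t.1, fun _ => rfl, fun _ _ _ _ h => by have := TwoNW.Wave.bounds h; omega⟩
    · obtain ⟨g, -, hg⟩ := TwoNW.exists_by_role ω k t.1 (fun _ _ _ k => (G (k - 1)).1)
        (fun _ _ _ _ => t.1) (fun _ _ _ _ => t.1) (fun _ _ _ _ => t.1)
      exact ⟨g, fun h => by omega, fun _ _ _ _ h => (hg _ _ _ _ h).1⟩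
  have hS : ∀ c, ∃ s, (c = 0 → s = t.2.1) ∧ ∀ k₁ k₂ k₃ k₄, ω.Wave k₁ k₂ k₃ k₄ →
      (c = k₁ → s = (G (k₄ - 1)).2.1) ∧ (c = k₂ → s = (G (k₃ - 1)).2.1) := by
    intro k
    rcases Nat.eq_zero_or_pos k with rfl | hk
    · exact ⟨t.2.1, fun _ => rfl, fun _ _ _ _ h => by have := TwoNW.Wave.bounds h; omega⟩
    · obtain ⟨g, -, hg⟩ := TwoNW.exists_by_role ω k t.2.1 (fun _ _ _ k => (G (k - 1)).2.1)
        (fun _ _ k _ => (G (k - 1)).2.1) (fun _ _ _ _ => t.2.1) (fun _ _ _ _ => t.2.1)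
      exact ⟨g, fun h => by omega, fun _ _ _ _ h => ⟨(hg _ _ _ _ h).1, (hg _ _ _ _ h).2.1⟩⟩
  choose H H0 hH using hH
  choose S S0 hS using hS
  have key : ∀ m i, i + m = ω.word.length → (G i).1 = H (w i) ∧ (G i).2.1 = S (ω.M2.top i) := by
    intro m
    induction m using Nat.strong_induction_on with
    | _ m ih =>
      intro i him
      rcases Nat.eq_zero_or_pos m with rfl | hm
      · have : i = ω.word.length := by omega
        rw [this, Gn, wn, Matching.top_length, H0 0 rfl, S0 0 rfl]
        exact ⟨rfl, rfl⟩
      have next : ∀ j, i < j → j ≤ ω.word.length →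
          (G j).1 = H (w j) ∧ (G j).2.1 = S (ω.M2.top j) := fun j h1 h2 =>
        ih (ω.word.length - j) (by omega) j (by omega)
      obtain ⟨j, rfl, hj⟩ : ∃ j, i = j - 1 ∧ 1 ≤ j := ⟨i + 1, rfl, by omega⟩
      rcases hw.position_cases hj (by omega) with h | ⟨k₁, k₂, k₃, k₄, h, hk⟩
      · obtain ⟨e1, e2, -⟩ := Gint j h
        rw [e1, e2, wint j h, ← Matching.top_int h.1 h.2.2.2]
        exact next j (by omega) (by omega)
      have hb := TwoNW.Wave.bounds h
      obtain ⟨⟨e1, e2, -⟩, e3, e4, e5, -⟩ := Gwave _ _ _ _ h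
      obtain ⟨w1, w2, w3, w4, w5, w6, w7⟩ := wwave _ _ _ _ h
      have HH := hH k₁ _ _ _ _ h rfl
      have S1 := (hS k₁ _ _ _ _ h).1 rfl
      have S2 := (hS k₂ _ _ _ _ h).2 rfl
      have n4 := next k₄ (by omega) (by omega)
      obtain ⟨-, -, -, -, -, h23, h14⟩ := h
      rcases hk with rfl | rfl | rfl | rfl
      · rw [e3, e4, n4.1, n4.2, w7, Matching.top_ret h14]
        exact ⟨rfl, rfl⟩
      · have n3 := next k₃ (by omega) (by omega)
        rw [e1, e2, n3.1, n3.2, w2, w5, Matching.top_ret h23]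
        exact ⟨rfl, rfl⟩
      · refine ⟨?_, by rw [Matching.top_pred_ret h23, S2]⟩
        rw [e5, w4, ← w7]
        exact n4.1
      · rw [w6, Matching.top_pred_ret h14, HH, S1]
        exact ⟨rfl, rfl⟩
  have key : ∀ i ≤ ω.word.length, (G i).1 = H (w i) ∧ (G i).2.1 = S (ω.M2.top i) := fun i hi =>
    key (ω.word.length - i) i (by omega)
  have p := t.1.lab₁₂
  choose h1 hh1 using fun i => (TwoNW.exists_by_role ω i p (fun _ _ _ k => (G (k - 1)).1.lab₁₂)
    (fun _ _ _ _ => p) (fun _ _ _ k => (G (k - 1)).1.lab₃₄) (fun _ _ _ _ => p))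
  choose h2 hh2 using fun i => (TwoNW.exists_by_role ω i p (fun _ _ _ k => (G (k - 1)).1.lab₁₄)
    (fun _ _ _ k => (G (k - 1)).1.lab₂₃) (fun _ _ _ _ => p) (fun _ _ _ _ => p))
  refine ⟨fun i => (G i).2.2, h1, h2, (isRun_iff hw).2
    ⟨fun i hi => (Gint i hi).2.2, fun k₁ k₂ k₃ k₄ h => ?_⟩, ?_, congrArg (fun u => u.2.2) Gn⟩
  · have hb := TwoNW.Wave.bounds h
    obtain ⟨⟨-, -, a₂, a₃, l2, l3, r2, r3⟩, -, -, e5, a₁, a₄, l1, l4, r1, r4⟩ := Gwave _ _ _ _ h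
    have lab : h1 k₁ = (G (k₄ - 1)).1.lab₁₂ ∧ h1 k₃ = (G (k₄ - 1)).1.lab₃₄ ∧
        h2 k₁ = (G (k₄ - 1)).1.lab₁₄ ∧ h2 k₂ = (G (k₄ - 1)).1.lab₂₃ :=
      ⟨((hh1 k₁).2 _ _ _ _ h).1 rfl, ((hh1 k₃).2 _ _ _ _ h).2.2.1 rfl,
        ((hh2 k₁).2 _ _ _ _ h).1 rfl, ((hh2 k₂).2 _ _ _ _ h).2.1 rfl⟩
    obtain ⟨t1, t2, -, -⟩ := hT.wave _ _ _ _ h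
    have m1 : (G k₁).2.1 = (G k₁).2.2 := by
      have := mem k₁ (by omega)
      rwa [t1] at this
    have m2 : (G k₂).2.1 = (G k₂).2.2 := by
      have := mem k₂ (by omega)
      rwa [t2] at this
    have g3 : (G k₃).1 = (G (k₄ - 1)).1 := by
      rw [(key k₃ (by omega)).1, (wwave _ _ _ _ h).2.2.2.2.1, hH k₁ _ _ _ _ h rfl]
    have s1 : (G k₁).2.2 = (G (k₄ - 1)).2.1 := by
      rw [← m1, (key k₁ (by omega)).2, Matching.top_call h.2.2.2.2.2.2, (hS k₁ _ _ _ _ h).1 rfl]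
    have s2 : (G k₂).2.2 = (G (k₄ - 1)).1.after₂ := by
      rw [← m2, (key k₂ (by omega)).2, Matching.top_call h.2.2.2.2.2.1, (hS k₂ _ _ _ _ h).2 rfl, e5]
    have s3 : (G (k₃ - 1)).2.2 = (G (k₄ - 1)).1.before₃ := by rw [e5]
    rw [g3] at r2 r3
    refine ⟨⟨a₁, l1, ?_⟩, ⟨a₂, l2, ?_⟩, ⟨a₃, l3, ?_⟩, ⟨a₄, l4, ?_⟩⟩ <;>
      simp only [lab, s1, s2, s3]
    exacts [r1, r2, r3, r4]
  · have := mem 0 (Nat.zero_le _)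
    rw [hT.zero] at this
    have h0 := (key 0 (Nat.zero_le _)).2
    rw [Matching.top_zero, S0 0 rfl] at h0
    exact (show (G 0).2.1 = (G 0).2.2 from this).symm.trans h0

theorem accepts_iff_determinize_accepts {ω : TwoNW α} (hw : ω.IsWaveWord) :
    A.Accepts ω ↔ A.determinize.Accepts ω := by
  rw [determinize_accepts_iff A hw]
  constructor
  · rintro ⟨ℓ, h1, h2, hrun, h0, hn⟩
    obtain ⟨T, hT⟩ := A.exists_isSummarySeq ω
    obtain ⟨g, hg⟩ := hT.complete hw hrun
    exact ⟨T, hT, _, hg, h0, hn⟩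
  · rintro ⟨T, hT, t, ht, h0, hn⟩
    obtain ⟨ℓ, h1, h2, hrun, e0, en⟩ := hT.sound hw ht
    exact ⟨ℓ, h1, h2, hrun, e0 ▸ h0, en ▸ hn⟩

end TwoNWA

/-- 2NWA are determinizable on the subclass of 2-wave words. -/
theorem determinizable_on_wave_words (α Q P : Type) [Finite α] [Finite Q] [Finite P]
    (A : TwoNWA α Q P) :
    ∃ (Q' P' : Type) (_ : Finite Q') (_ : Finite P') (A' : TwoNWA α Q' P'),
      A'.Deterministic ∧ A.langWW = A'.langWW := by
  refine ⟨_, _, inferInstance, inferInstance, A.determinize, A.determinize_deterministic, ?_⟩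
  ext ω
  exact and_congr_left fun hw => TwoNWA.accepts_iff_determinize_accepts hw
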